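/- arXiv:2502.10035 — 2 statements merged into one kernel-verified Lean document; each statement's English description precedes it below -/
import Mathlib

section
/- Suppose there exists a lower-solution φ ∈ C¹(0,1) of ż = c g(u) − f(u) − h(u)/z^α on (0,1) with φ(0⁺) = 0 and φ(u) > 0 for all u ∈ (0,1). Then there exists z ∈ C¹(0,1) solving the full singular boundary value problem: ż = c g − f − h/z^α on (0,1), z > 0 on (0,1), z(0⁺) = 0, z(1⁻) = 0; moreover 0 < z(u) ≤ φ(u) for every u ∈ (0,1). -/
open Set Filter Topology Real

/-- Backward comparison. -/
lemma aux_cmp {w : ℝ → ℝ} {a b : ℝ} (hw : ContinuousOn w (Icc a b)) (hb : w b ≤ 0)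
    (hd : ∀ s ∈ Ioo a b, 0 < w s → ∃ d, 0 ≤ d ∧ HasDerivAt w d s) :
    ∀ s ∈ Icc a b, w s ≤ 0 := by
  intro s₀ hs₀
  by_contra hpos
  push Not at hpos
  set S := Icc s₀ b ∩ w ⁻¹' (Iic 0) with hS
  have hws : ContinuousOn w (Icc s₀ b) := hw.mono (Icc_subset_Icc_left hs₀.1)
  have hSc : IsClosed S := hws.preimage_isClosed_of_isClosed isClosed_Icc isClosed_Iic
  have hSne : S.Nonempty := ⟨b, ⟨hs₀.2, le_rfl⟩, hb⟩
  have hSb : BddBelow S := ⟨s₀, fun x hx => hx.1.1⟩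
  have ht : sInf S ∈ S := hSc.csInf_mem hSne hSb
  set t := sInf S with htdef
  have htw : w t ≤ 0 := ht.2
  have hlt : s₀ < t := by
    rcases lt_or_eq_of_le ht.1.1 with h | h
    · exact h
    · rw [← h] at htw; linarith
  have hin : ∀ s ∈ Ioo s₀ t, 0 < w s := by
    intro s hs
    by_contra hc
    push Not at hc
    have : t ≤ s := csInf_le hSb ⟨⟨hs.1.le, hs.2.le.trans ht.1.2⟩, hc⟩
    linarith [hs.2]
  have hd' : ∀ s ∈ Ioo s₀ t, ∃ d, 0 ≤ d ∧ HasDerivAt w d s := fun s hs =>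
    hd s ⟨hs₀.1.trans_lt hs.1, hs.2.trans_le ht.1.2⟩ (hin s hs)
  have hmono : MonotoneOn w (Icc s₀ t) := by
    apply monotoneOn_of_deriv_nonneg (convex_Icc _ _)
    · exact hws.mono (Icc_subset_Icc_right ht.1.2)
    · rw [interior_Icc]
      intro s hs
      obtain ⟨d, -, h⟩ := hd' s hs
      exact h.differentiableAt.differentiableWithinAt
    · rw [interior_Icc]
      intro s hs
      obtain ⟨d, h0, h⟩ := hd' s hs
      rw [h.deriv]; exact h0
  have := hmono ⟨le_rfl, hlt.le⟩ ⟨hlt.le, le_rfl⟩ hlt.le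
  linarith

lemma aux_lip {α ε : ℝ} (hα : 0 < α) (hε : 0 < ε) (x y : ℝ) :
    |1 / (max x ε) ^ α - 1 / (max y ε) ^ α| ≤ (α * ε ^ (-α - 1)) * |x - y| := by
  have hm : ∀ x : ℝ, 0 < max x ε := fun x => lt_max_of_lt_right hε
  have h1 : ∀ x : ℝ, 1 / (max x ε) ^ α = (max x ε) ^ (-α) := fun x => by
    rw [rpow_neg (hm x).le, one_div]
  rw [h1, h1]
  have h2 := Convex.norm_image_sub_le_of_norm_hasDerivWithin_le (s := Ici ε)
    (f := fun x : ℝ => x ^ (-α)) (f' := fun x => (-α) * x ^ (-α - 1)) (C := α * ε ^ (-α - 1))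
    (x := max y ε) (y := max x ε)
    (fun x hx => (hasDerivAt_rpow_const (Or.inl (hε.trans_le hx).ne')).hasDerivWithinAt)
    (fun x hx => by
      have hx0 : 0 < x := hε.trans_le hx
      rw [norm_mul, norm_neg, Real.norm_of_nonneg hα.le,
        Real.norm_of_nonneg (rpow_nonneg hx0.le _)]
      exact mul_le_mul_of_nonneg_left
        (rpow_le_rpow_of_nonpos hε hx (by linarith)) hα.le)
    (convex_Ici ε) (mem_Ici.2 (le_max_right _ _)) (mem_Ici.2 (le_max_right _ _))
  refine h2.trans (mul_le_mul_of_nonneg_left ?_ (by positivity))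
  exact abs_max_sub_max_le_abs x y ε

lemma aux_exists {α ε K H : ℝ} (hα : 0 < α) (hε : 0 < ε) {k h : ℝ → ℝ}
    (hk : Continuous k) (hh : Continuous h) (hK : ∀ t, |k t| ≤ K)
    (hh0 : ∀ t, 0 ≤ h t) (hH : ∀ t, h t ≤ H) :
    ∃ z : ℝ → ℝ, z 1 = 0 ∧ ∀ t ∈ Icc (0:ℝ) 1,
      HasDerivAt z (k t - h t / (max (z t) ε) ^ α) t := by
  have hK0 : 0 ≤ K := (abs_nonneg _).trans (hK 0)
  have hH0 : 0 ≤ H := (hh0 0).trans (hH 0)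
  have hm : ∀ x : ℝ, 0 < max x ε := fun x => lt_max_of_lt_right hε
  have hεp : 0 < ε ^ α := rpow_pos_of_pos hε _
  let L : NNReal := ⟨K + H / ε ^ α, by positivity⟩
  let C : NNReal := ⟨H * (α * ε ^ (-α - 1)), by positivity⟩
  have hpl : IsPicardLindelof (fun t x => k t - h t / (max x ε) ^ α)
      (tmin := -1) (tmax := 2) ⟨1, by norm_num, by norm_num⟩ (0:ℝ) (L * 2) 0 L C := by
    constructor
    · intro t _
      apply LipschitzOnWith.of_dist_le_mul
      intro x _ y _
      rw [Real.dist_eq, Real.dist_eq]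
      have e : k t - h t / (max x ε) ^ α - (k t - h t / (max y ε) ^ α)
        = - (h t * (1 / (max x ε) ^ α - 1 / (max y ε) ^ α)) := by ring
      rw [e, abs_neg, abs_mul, abs_of_nonneg (hh0 t)]
      calc h t * |1 / (max x ε) ^ α - 1 / (max y ε) ^ α|
          ≤ H * ((α * ε ^ (-α - 1)) * |x - y|) :=
            mul_le_mul (hH t) (aux_lip hα hε x y) (abs_nonneg _) hH0
        _ = (H * (α * ε ^ (-α - 1))) * |x - y| := by ring
    · intro x _
      exact (hk.sub (hh.div_const _)).continuousOn
    · intro t _ x _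
      rw [Real.norm_eq_abs]
      have h1 : |h t / (max x ε) ^ α| ≤ H / ε ^ α := by
        rw [abs_of_nonneg (div_nonneg (hh0 t) (rpow_nonneg (hm x).le _))]
        exact div_le_div₀ hH0 (hH t) hεp (rpow_le_rpow hε.le (le_max_right _ _) hα.le)
      calc _ ≤ |k t| + |h t / (max x ε) ^ α| := abs_sub _ _
        _ ≤ K + H / ε ^ α := add_le_add (hK t) h1
        _ = L := rfl
    · have : max ((2:ℝ) - 1) (1 - (-1)) = 2 := by norm_num
      show (L:ℝ) * max ((2:ℝ) - 1) (1 - (-1)) ≤ ((L * 2 : NNReal) : ℝ) - ((0 : NNReal) : ℝ)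
      rw [this]; simp
  obtain ⟨z, hz1, hz⟩ := hpl.exists_eq_forall_mem_Icc_hasDerivWithinAt₀
  refine ⟨z, hz1, fun t ht => ?_⟩
  exact (hz t ⟨by linarith [ht.1], by linarith [ht.2]⟩).hasDerivAt
    (Icc_mem_nhds (by linarith [ht.1]) (by linarith [ht.2]))

lemma aux_main {α K H : ℝ} (hα : 0 < α) {k h : ℝ → ℝ}
    (hk : Continuous k) (hh : Continuous h) (hK : ∀ t, |k t| ≤ K)
    (hh0 : ∀ t, 0 ≤ h t) (hH : ∀ t, h t ≤ H) (hhpos : ∀ u ∈ Ioo (0:ℝ) 1, 0 < h u)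
    {φ φ' : ℝ → ℝ}
    (hφd : ∀ u ∈ Ioo (0:ℝ) 1, HasDerivAt φ (φ' u) u)
    (hφpos : ∀ u ∈ Ioo (0:ℝ) 1, 0 < φ u)
    (hφ0 : Tendsto φ (𝓝[>] (0:ℝ)) (𝓝 0))
    (hlower : ∀ u ∈ Ioo (0:ℝ) 1, φ' u ≤ k u - h u / φ u ^ α) :
    ∃ z : ℝ → ℝ,
      (∀ u ∈ Ioo (0:ℝ) 1, HasDerivAt z (k u - h u / z u ^ α) u) ∧
      (∀ u ∈ Ioo (0:ℝ) 1, 0 < z u ∧ z u ≤ φ u) ∧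
      Tendsto z (𝓝[>] (0:ℝ)) (𝓝 0) ∧
      Tendsto z (𝓝[<] (1:ℝ)) (𝓝 0) := by
  have hK0 : 0 ≤ K := (abs_nonneg _).trans (hK 0)
  have hH0 : 0 ≤ H := (hh0 0).trans (hH 0)
  set ε : ℕ → ℝ := fun n => 1 / ((n:ℝ) + 1) with hεdef
  have hε : ∀ n, 0 < ε n := fun n => by positivity
  have hεanti : ∀ m n, m ≤ n → ε n ≤ ε m := fun m n hmn => one_div_le_one_div_of_le
    (by positivity) (by have : (m:ℝ) ≤ n := by exact_mod_cast hmn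
                        linarith)
  have hεlim : Tendsto ε atTop (𝓝 0) := tendsto_one_div_add_atTop_nhds_zero_nat
  choose Z hZ1 hZ using fun n => aux_exists hα (hε n) hk hh hK hh0 hH
  have hm : ∀ n x, 0 < max x (ε n) := fun n x => lt_max_of_lt_right (hε n)
  have hZc : ∀ n, ContinuousOn (Z n) (Icc 0 1) := fun n t ht =>
    (hZ n t ht).continuousAt.continuousWithinAt
  -- antitone dependence of the singular term
  have hdiv : ∀ t x y : ℝ, 0 < x → x ≤ y → h t / y ^ α ≤ h t / x ^ α := fun t x y hx hxy =>
    div_le_div_of_nonneg_left (hh0 t) (rpow_pos_of_pos hx _) (rpow_le_rpow hx.le hxy hα.le)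
  -- monotone in n
  have hmono : ∀ t ∈ Icc (0:ℝ) 1, Monotone (fun n => Z n t) := by
    intro t ht m n hmn
    have := aux_cmp (w := fun s => Z m s - Z n s) (a := 0) (b := 1)
      ((hZc m).sub (hZc n)) (by simp [hZ1]) (fun s hs hpos => by
        have hs' := Ioo_subset_Icc_self hs
        refine ⟨_, ?_, (hZ m s hs').sub (hZ n s hs')⟩
        have := hdiv s (max (Z n s) (ε n)) (max (Z m s) (ε m)) (hm _ _)
          (max_le_max (by linarith) (hεanti _ _ hmn))
        linarith) t ht
    simpa using this
  -- upper barrier near 1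
  have hup : ∀ η, 0 < η → ∀ n, ∀ t ∈ Icc (0:ℝ) 1, Z n t ≤ η + (K + H / η ^ α) * (1 - t) := by
    intro η hη n t ht
    have := aux_cmp (w := fun s => Z n s - (η + (K + H / η ^ α) * (1 - s))) (a := 0) (b := 1)
      ((hZc n).sub (by fun_prop)) (by simp [hZ1, hη.le]) (fun s hs hpos => by
        have hs' := Ioo_subset_Icc_self hs
        have hη' : 0 < η ^ α := rpow_pos_of_pos hη _
        refine ⟨_, ?_, (hZ n s hs').sub
          ((((hasDerivAt_id s).const_sub 1).const_mul (K + H / η ^ α)).const_add η)⟩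
        have hge : 0 ≤ (K + H / η ^ α) * (1 - s) :=
          mul_nonneg (by positivity) (by linarith [hs.2])
        have h1 := hdiv s η (max (Z n s) (ε n)) hη (le_max_of_le_left (by linarith))
        have h2 : h s / η ^ α ≤ H / η ^ α := div_le_div_of_nonneg_right (hH s) hη'.le
        have h3 := (abs_le.1 (hK s)).1
        linarith) t ht
    linarith
  -- crude lower bound
  have hlow : ∀ n, ∀ t ∈ Icc (0:ℝ) 1, -K ≤ Z n t := by
    intro n t ht
    have := aux_cmp (w := fun s => (-K) * (1 - s) - Z n s) (a := 0) (b := 1)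
      (ContinuousOn.sub (by fun_prop) (hZc n)) (by simp [hZ1]) (fun s hs hpos => by
        have hs' := Ioo_subset_Icc_self hs
        refine ⟨_, ?_, (((hasDerivAt_id s).const_sub 1).const_mul (-K)).sub (hZ n s hs')⟩
        have h1 : 0 ≤ h s / (max (Z n s) (ε n)) ^ α :=
          div_nonneg (hh0 s) (rpow_nonneg (hm _ _).le _)
        have h3 := (abs_le.1 (hK s)).2
        linarith) t ht
    have h4 : K * (1 - t) ≤ K * 1 := mul_le_mul_of_nonneg_left (by linarith [ht.1]) hK0
    linarith
  -- below φ
  have hφle : ∀ n, ∀ t ∈ Ioo (0:ℝ) 1, Z n t ≤ φ t := by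
    intro n t ht
    apply le_of_forall_pos_le_add
    intro δ hδ
    have hcont : ContinuousAt (Z n) 1 := (hZ n 1 ⟨zero_le_one, le_rfl⟩).continuousAt
    have hev : ∀ᶠ v in 𝓝[<] (1:ℝ), Z n v < δ :=
      (hcont.tendsto.mono_left nhdsWithin_le_nhds).eventually (gt_mem_nhds (by rw [hZ1]; exact hδ))
    have hev2 : ∀ᶠ v in 𝓝[<] (1:ℝ), v ∈ Ioo t 1 := Ioo_mem_nhdsLT ht.2
    obtain ⟨v, hv1, hv2⟩ := (hev.and hev2).exists
    have hsub : ∀ s ∈ Icc t v, s ∈ Ioo (0:ℝ) 1 := fun s hs =>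
      ⟨ht.1.trans_le hs.1, hs.2.trans_lt hv2.2⟩
    have := aux_cmp (w := fun s => Z n s - (φ s + δ)) (a := t) (b := v)
      (fun s hs => ((hZ n s (Ioo_subset_Icc_self (hsub s hs))).continuousAt.sub
        ((hφd s (hsub s hs)).continuousAt.add continuousAt_const)).continuousWithinAt)
      (by have := hφpos v (hsub v ⟨hv2.1.le, le_rfl⟩)
          show Z n v - (φ v + δ) ≤ 0
          linarith) (fun s hs hpos => by
        have hs' := hsub s (Ioo_subset_Icc_self hs)
        refine ⟨_, ?_, (hZ n s (Ioo_subset_Icc_self hs')).sub ((hφd s hs').add_const δ)⟩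
        have h1 := hdiv s (φ s) (max (Z n s) (ε n)) (hφpos s hs')
          (le_max_of_le_left (by linarith))
        have h2 := hlower s hs'
        linarith) t ⟨le_rfl, hv2.1.le⟩
    linarith
  -- uniform positive lower bound on compact subintervals
  have hposlow : ∀ a b : ℝ, 0 < a → a ≤ b → b < 1 → ∃ η, 0 < η ∧ ∀ᶠ n in atTop,
      ε n ≤ η ∧ ∀ t ∈ Icc a b, η ≤ Z n t := by
    intro a b ha hab hb
    set v := (1 + b) / 2 with hv
    have hbv : b < v := by rw [hv]; linarith
    have hv1 : v < 1 := by rw [hv]; linarith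
    obtain ⟨x, hx, hxmin⟩ := isCompact_Icc.exists_isMinOn
      (nonempty_Icc.2 (hab.trans hbv.le)) hh.continuousOn (s := Icc a v)
    have hmpos : 0 < h x := hhpos x ⟨ha.trans_le hx.1, hx.2.trans_lt hv1⟩
    set M := (K + 1) / (v - b) with hM
    have hvb : 0 < v - b := by linarith
    have hM0 : 0 < M := by positivity
    have hlim : Tendsto (fun y : ℝ => y ^ α * (K + M)) (𝓝[>] 0) (𝓝 0) := by
      have : ContinuousAt (fun y : ℝ => y ^ α * (K + M)) 0 :=
        (continuousAt_id.rpow_const (Or.inr hα.le)).mul continuousAt_const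
      have h2 := this.tendsto.mono_left (nhdsWithin_le_nhds (s := Ioi 0))
      simpa [zero_rpow hα.ne'] using h2
    obtain ⟨η, hη1, hη2⟩ := ((hlim.eventually (gt_mem_nhds hmpos)).and
      (Ioo_mem_nhdsGT (zero_lt_one (α := ℝ)))).exists
    have hη0 : 0 < η := hη2.1
    have hηp : 0 < η ^ α := rpow_pos_of_pos hη0 _
    refine ⟨η, hη0, ?_⟩
    filter_upwards [hεlim.eventually (gt_mem_nhds hη0)] with n hn
    refine ⟨hn.le, fun t ht => ?_⟩
    have hsub : ∀ s ∈ Icc t v, s ∈ Icc (0:ℝ) 1 := fun s hs =>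
      ⟨ha.le.trans (ht.1.trans hs.1), hs.2.trans hv1.le⟩
    have htv : t ≤ v := ht.2.trans hbv.le
    have := aux_cmp (w := fun s => (η - M * (s - t)) - Z n s) (a := t) (b := v)
      (ContinuousOn.sub (by fun_prop) ((hZc n).mono hsub))
      (by have h1 := hlow n v (hsub v ⟨htv, le_rfl⟩)
          have h2 : K + 1 ≤ M * (v - t) := by
            have : M * (v - b) = K + 1 := by rw [hM]; field_simp
            have h3 : M * (v - b) ≤ M * (v - t) :=
              mul_le_mul_of_nonneg_left (by linarith [ht.2]) hM0.le
            linarith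
          show (η - M * (v - t)) - Z n v ≤ 0
          linarith [hη2.2]) (fun s hs hpos => by
        have hs' := hsub s (Ioo_subset_Icc_self hs)
        refine ⟨_, ?_, ((((hasDerivAt_id s).sub_const t).const_mul M).const_sub η).sub (hZ n s hs')⟩
        have h0 : 0 ≤ M * (s - t) := mul_nonneg hM0.le (by linarith [hs.1])
        have h1 := hdiv s (max (Z n s) (ε n)) η (hm _ _) (max_le (by linarith) hn.le)
        have h2 : K + M ≤ h s / η ^ α := by
          rw [le_div_iff₀ hηp]
          have h5 : h x ≤ h s := hxmin ⟨ht.1.trans hs.1.le, hs.2.le⟩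
          linarith
        have h3 := (abs_le.1 (hK s)).2
        linarith) t ⟨le_rfl, htv⟩
    simp only [sub_self, mul_zero] at this
    linarith
  -- the limit
  have hex : ∀ t, ∃ l, t ∈ Icc (0:ℝ) 1 → Tendsto (fun n => Z n t) atTop (𝓝 l) := by
    intro t
    by_cases ht : t ∈ Icc (0:ℝ) 1
    · exact ⟨_, fun _ => tendsto_atTop_ciSup (hmono t ht)
        ⟨_, by rintro _ ⟨n, rfl⟩; exact hup 1 one_pos n t ht⟩⟩
    · exact ⟨0, fun h => absurd h ht⟩
  choose z hz using hex
  have hzφ : ∀ u ∈ Ioo (0:ℝ) 1, z u ≤ φ u := fun u hu =>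
    le_of_tendsto' (hz u (Ioo_subset_Icc_self hu)) (fun n => hφle n u hu)
  have hzpos : ∀ u ∈ Ioo (0:ℝ) 1, 0 < z u := by
    intro u hu
    obtain ⟨η, hη, hev⟩ := hposlow u u hu.1 le_rfl hu.2
    exact hη.trans_le (ge_of_tendsto (hz u (Ioo_subset_Icc_self hu))
      (hev.mono fun n hn => hn.2 u ⟨le_rfl, le_rfl⟩))
  have hzup : ∀ η, 0 < η → ∀ t ∈ Icc (0:ℝ) 1, z t ≤ η + (K + H / η ^ α) * (1 - t) :=
    fun η hη t ht => le_of_tendsto' (hz t ht) (fun n => hup η hη n t ht)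
  refine ⟨z, ?_, fun u hu => ⟨hzpos u hu, hzφ u hu⟩, ?_, ?_⟩
  · intro u hu
    set a := u / 2 with hadef
    set b := (1 + u) / 2 with hbdef
    have ha : 0 < a := by rw [hadef]; linarith [hu.1]
    have hau : a < u := by rw [hadef]; linarith [hu.1]
    have hub : u < b := by rw [hbdef]; linarith [hu.2]
    have hb : b < 1 := by rw [hbdef]; linarith [hu.2]
    have hsub : ∀ s ∈ Icc a b, s ∈ Ioo (0:ℝ) 1 := fun s hs =>
      ⟨ha.trans_le hs.1, hs.2.trans_lt hb⟩
    have hsub' : ∀ s ∈ Icc a b, s ∈ Icc (0:ℝ) 1 := fun s hs => Ioo_subset_Icc_self (hsub s hs)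
    obtain ⟨η, hη, hev⟩ := hposlow a b ha (hau.trans hub).le hb
    have hηp : 0 < η ^ α := rpow_pos_of_pos hη _
    set C := K + H / η ^ α with hC
    have hbd : ∀ᶠ n in atTop, ∀ t ∈ Icc a b, ‖k t - h t / (max (Z n t) (ε n)) ^ α‖ ≤ C := by
      filter_upwards [hev] with n hn t ht
      rw [Real.norm_eq_abs]
      have h1 := hdiv t η (max (Z n t) (ε n)) hη (le_max_of_le_left (hn.2 t ht))
      have h2 : h t / η ^ α ≤ H / η ^ α := div_le_div_of_nonneg_right (hH t) hηp.le
      have h3 : |h t / (max (Z n t) (ε n)) ^ α| ≤ H / η ^ α := by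
        rw [abs_of_nonneg (div_nonneg (hh0 t) (rpow_nonneg (hm _ _).le _))]
        linarith
      calc _ ≤ |k t| + |h t / (max (Z n t) (ε n)) ^ α| := abs_sub _ _
        _ ≤ C := add_le_add (hK t) h3
    -- the limit is Lipschitz on `[a,b]`
    have hlip : ∀ s ∈ Icc a b, ∀ t ∈ Icc a b, ‖z t - z s‖ ≤ C * ‖t - s‖ := by
      intro s hs t ht
      refine le_of_tendsto ((hz t (hsub' t ht)).sub (hz s (hsub' s hs))).norm ?_
      filter_upwards [hbd] with n hn
      exact Convex.norm_image_sub_le_of_norm_hasDerivWithin_le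
        (fun x hx => (hZ n x (hsub' x hx)).hasDerivWithinAt) hn (convex_Icc a b) hs ht
    have hzc : ContinuousOn z (Icc a b) := by
      have : LipschitzOnWith C.toNNReal z (Icc a b) :=
        LipschitzOnWith.of_dist_le_mul (fun x hx y hy => by
          rw [Real.coe_toNNReal C (by positivity), dist_eq_norm, dist_eq_norm]
          exact hlip y hy x hx)
      exact this.continuousOn
    set F : ℝ → ℝ := fun t => k t - h t / z t ^ α with hF
    have hFc : ContinuousOn F (Icc a b) :=
      hk.continuousOn.sub (hh.continuousOn.div (hzc.rpow_const fun x _ => Or.inr hα.le)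
        fun x hx => (rpow_pos_of_pos (hzpos x (hsub x hx)) _).ne')
    have hFnc : ∀ n, ContinuousOn (fun t => k t - h t / (max (Z n t) (ε n)) ^ α) (Icc a b) :=
      fun n => hk.continuousOn.sub (hh.continuousOn.div
        ((ContinuousOn.sup ((hZc n).mono hsub') continuousOn_const).rpow_const fun x _ => Or.inr hα.le)
        fun x hx => (rpow_pos_of_pos (hm _ _) _).ne')
    have hint : ∀ t ∈ Icc a b, z t = z a + ∫ s in a..t, F s := by
      intro t ht
      have haI : a ∈ Icc a b := ⟨le_rfl, (hau.trans hub).le⟩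
      have hsubt : uIcc a t ⊆ Icc a b := by
        rw [uIcc_of_le ht.1]; exact Icc_subset_Icc_right ht.2
      have hsubI : Set.uIoc a t ⊆ Icc a b := uIoc_subset_uIcc.trans hsubt
      have h1 : Tendsto (fun n => ∫ s in a..t, (k s - h s / (max (Z n s) (ε n)) ^ α)) atTop
          (𝓝 (∫ s in a..t, F s)) := by
        apply intervalIntegral.tendsto_integral_filter_of_dominated_convergence (fun _ => C)
        · exact Eventually.of_forall fun n =>
            ((hFnc n).mono hsubI).aestronglyMeasurable measurableSet_uIoc
        · filter_upwards [hbd] with n hn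
          exact Eventually.of_forall fun x hx => hn x (hsubI hx)
        · exact intervalIntegrable_const
        · refine Eventually.of_forall fun x hx => ?_
          have hx' := hsubI hx
          have hmax : Tendsto (fun n => max (Z n x) (ε n)) atTop (𝓝 (z x)) := by
            have := (hz x (hsub' x hx')).max hεlim
            rwa [max_eq_left (hzpos x (hsub x hx')).le] at this
          have hp := hmax.rpow_const (p := α) (Or.inr hα.le)
          exact tendsto_const_nhds.sub (tendsto_const_nhds.div hp
            (rpow_pos_of_pos (hzpos x (hsub x hx')) _).ne')
      have h2 : ∀ n, ∫ s in a..t, (k s - h s / (max (Z n s) (ε n)) ^ α) = Z n t - Z n a :=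
        fun n => intervalIntegral.integral_eq_sub_of_hasDerivAt
          (fun x hx => hZ n x (hsub' x (hsubt hx)))
          ((hFnc n).mono hsubt).intervalIntegrable
      simp only [h2] at h1
      have h3 := tendsto_nhds_unique h1 ((hz t (hsub' t ht)).sub (hz a (hsub' a haI)))
      linarith
    have hu' : Icc a b ∈ 𝓝 u := Icc_mem_nhds hau hub
    have hder : HasDerivAt (fun t => z a + ∫ s in a..t, F s) (F u) u := by
      refine HasDerivAt.const_add _ (intervalIntegral.integral_hasDerivAt_right ?_ ?_ ?_)
      · apply (hFc.mono _).intervalIntegrable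
        rw [uIcc_of_le hau.le]; exact Icc_subset_Icc_right hub.le
      · exact (hFc.mono Ioo_subset_Icc_self).stronglyMeasurableAtFilter isOpen_Ioo u ⟨hau, hub⟩
      · exact hFc.continuousAt hu'
    exact hder.congr_of_eventuallyEq (by filter_upwards [hu'] with t ht using hint t ht)
  · refine tendsto_of_tendsto_of_tendsto_of_le_of_le' tendsto_const_nhds hφ0 ?_ ?_
    · filter_upwards [Ioo_mem_nhdsGT (zero_lt_one (α := ℝ))] with u hu using (hzpos u hu).le
    · filter_upwards [Ioo_mem_nhdsGT (zero_lt_one (α := ℝ))] with u hu using hzφ u hu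
  · rw [tendsto_order]
    constructor
    · intro a ha
      filter_upwards [Ioo_mem_nhdsLT (zero_lt_one (α := ℝ))] with u hu using ha.trans (hzpos u hu)
    · intro a ha
      have hlim : Tendsto (fun t : ℝ => a / 2 + (K + H / (a / 2) ^ α) * (1 - t)) (𝓝[<] 1)
          (𝓝 (a / 2)) := by
        have : Continuous (fun t : ℝ => a / 2 + (K + H / (a / 2) ^ α) * (1 - t)) := by fun_prop
        have h2 := (this.tendsto 1).mono_left (nhdsWithin_le_nhds (s := Iio 1))
        simpa using h2
      filter_upwards [Ioo_mem_nhdsLT (zero_lt_one (α := ℝ)),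
        hlim.eventually (gt_mem_nhds (show a / 2 < a by linarith))] with u hu hu2
      exact (hzup (a / 2) (by linarith) u (Ioo_subset_Icc_self hu)).trans_lt hu2

/-- Existence via a lower-solution: if `φ` is a positive `C¹` lower-solution on
`(0,1)` with `φ(0⁺) = 0`, then the full singular boundary value problem has a
solution `z` with `0 < z ≤ φ` on `(0,1)`. -/
theorem stmt_14 (α c : ℝ) (hα : 0 < α) (f g h : ℝ → ℝ)
    (hf : ContinuousOn f (Icc 0 1)) (hg : ContinuousOn g (Icc 0 1))
    (hh : ContinuousOn h (Icc 0 1))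
    (hh0 : h 0 = 0) (hh1 : h 1 = 0) (hhpos : ∀ u ∈ Ioo (0:ℝ) 1, 0 < h u)
    (φ φ' : ℝ → ℝ)
    (hφd : ∀ u ∈ Ioo (0:ℝ) 1, HasDerivAt φ (φ' u) u)
    (hφ'c : ContinuousOn φ' (Ioo 0 1))
    (hφpos : ∀ u ∈ Ioo (0:ℝ) 1, 0 < φ u)
    (hφ0 : Tendsto φ (𝓝[>] (0:ℝ)) (𝓝 0))
    (hlower : ∀ u ∈ Ioo (0:ℝ) 1, φ' u ≤ c * g u - f u - h u / φ u ^ α) :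
    ∃ z : ℝ → ℝ,
      (∀ u ∈ Ioo (0:ℝ) 1, HasDerivAt z (c * g u - f u - h u / z u ^ α) u) ∧
      (∀ u ∈ Ioo (0:ℝ) 1, 0 < z u ∧ z u ≤ φ u) ∧
      Tendsto z (𝓝[>] (0:ℝ)) (𝓝 0) ∧
      Tendsto z (𝓝[<] (1:ℝ)) (𝓝 0) := by
  classical
  set k : ℝ → ℝ := IccExtend (zero_le_one (α := ℝ)) (fun x : Icc (0:ℝ) 1 => c * g x - f x) with hk
  set h₁ : ℝ → ℝ := IccExtend (zero_le_one (α := ℝ)) (fun x : Icc (0:ℝ) 1 => h x) with hh₁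
  have hkc : Continuous k := Continuous.Icc_extend'
    (continuousOn_iff_continuous_domRestrict.1 ((continuousOn_const.mul hg).sub hf))
  have hhc : Continuous h₁ := Continuous.Icc_extend' (continuousOn_iff_continuous_domRestrict.1 hh)
  have hke : ∀ u ∈ Ioo (0:ℝ) 1, k u = c * g u - f u := fun u hu =>
    IccExtend_of_mem _ _ (Ioo_subset_Icc_self hu)
  have hhe : ∀ u ∈ Ioo (0:ℝ) 1, h₁ u = h u := fun u hu =>
    IccExtend_of_mem _ _ (Ioo_subset_Icc_self hu)
  obtain ⟨K, hK⟩ := isCompact_Icc.exists_bound_of_continuousOn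
    (((continuousOn_const (c := c)).mul hg).sub hf)
  obtain ⟨H, hH⟩ := isCompact_Icc.exists_bound_of_continuousOn hh
  have hnn : ∀ x ∈ Icc (0:ℝ) 1, 0 ≤ h x := by
    intro x hx
    rcases eq_or_lt_of_le hx.1 with h0 | h0
    · rw [← h0, hh0]
    rcases eq_or_lt_of_le hx.2 with h1 | h1
    · rw [h1, hh1]
    exact (hhpos x ⟨h0, h1⟩).le
  obtain ⟨z, hz1, hz2⟩ := aux_main (K := K) (H := H) hα hkc hhc
    (fun t => hK _ (projIcc (0:ℝ) 1 zero_le_one t).2)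
    (fun t => hnn _ (projIcc (0:ℝ) 1 zero_le_one t).2)
    (fun t => (le_abs_self _).trans (hH _ (projIcc (0:ℝ) 1 zero_le_one t).2))
    (fun u hu => by rw [hhe u hu]; exact hhpos u hu) hφd hφpos hφ0
    (fun u hu => by rw [hhe u hu, hke u hu]; exact hlower u hu)
  refine ⟨z, fun u hu => ?_, hz2⟩
  have := hz1 u hu
  rwa [hhe u hu, hke u hu] at this
end

section
/- Under the hypotheses of the main theorem (g(0) > 0, ∫₀ᵘ g > 0 on (0,1], h_{α,0} finite), if problem (P) has a solution z* for c = c*, then it has a solution for every c > c*. Hence the set of admissible speeds is a half-line [c*, ∞). -/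
open Set Filter Topology Real intervalIntegral

/-- Backward comparison. -/
lemma aux_comp (p p' : ℝ → ℝ) (a b : ℝ) (hab : a ≤ b) (hc : ContinuousOn p (Icc a b))
    (hd : ∀ u ∈ Ioo a b, HasDerivAt p (p' u) u)
    (hp : ∀ u ∈ Ioo a b, 0 < p u → 0 ≤ p' u) (hb : p b ≤ 0) : p a ≤ 0 := by
  by_contra! hpa
  have hcl : IsClosed (Icc a b ∩ p ⁻¹' Iic 0) := hc.preimage_isClosed_of_isClosed isClosed_Icc isClosed_Iic
  have hne : (Icc a b ∩ p ⁻¹' Iic 0).Nonempty := ⟨b, ⟨hab, le_rfl⟩, hb⟩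
  have hbd : BddBelow (Icc a b ∩ p ⁻¹' Iic 0) := ⟨a, fun x hx => hx.1.1⟩
  have hs := hcl.csInf_mem hne hbd
  set s := sInf (Icc a b ∩ p ⁻¹' Iic 0) with hsdef
  have hpos : ∀ u ∈ Ioo a s, 0 < p u := by
    intro u hu
    by_contra! hpu
    exact absurd (csInf_le hbd ⟨⟨hu.1.le, hu.2.le.trans hs.1.2⟩, hpu⟩) (not_le.2 hu.2)
  have hsub : Ioo a s ⊆ Ioo a b := Ioo_subset_Ioo le_rfl hs.1.2
  have hm : MonotoneOn p (Icc a s) := by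
    apply monotoneOn_of_deriv_nonneg (convex_Icc a s) (hc.mono (Icc_subset_Icc le_rfl hs.1.2))
    · rw [interior_Icc]
      exact fun u hu => (hd u (hsub hu)).differentiableAt.differentiableWithinAt
    · rw [interior_Icc]
      intro u hu
      rw [(hd u (hsub hu)).deriv]
      exact hp u (hsub hu) (hpos u hu)
  have := hm ⟨le_rfl, hs.1.1⟩ ⟨hs.1.1, le_rfl⟩ hs.1.1
  have h2 : p s ≤ 0 := hs.2
  linarith

lemma aux_lip_s16 (α δ : ℝ) (hα : 0 < α) (hδ : 0 < δ) :
    ∃ C : NNReal, LipschitzWith C (fun x : ℝ => (max x δ ^ α)⁻¹) := by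
  have h1 : LipschitzOnWith (Real.toNNReal (α * δ ^ (-α - 1))) (fun x : ℝ => x ^ (-α)) (Ici δ) := by
    apply (convex_Ici δ).lipschitzOnWith_of_nnnorm_hasDerivWithin_le
      (f' := fun x => (-α) * x ^ (-α - 1))
    · intro x hx
      exact (Real.hasDerivAt_rpow_const (Or.inl (hδ.trans_le hx).ne')).hasDerivWithinAt
    · intro x hx
      have hx0 : 0 < x := hδ.trans_le hx
      rw [← NNReal.coe_le_coe, coe_nnnorm, Real.coe_toNNReal _ (by positivity), Real.norm_eq_abs,
        abs_mul, abs_neg, abs_of_pos hα, abs_of_pos (by positivity)]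
      exact mul_le_mul_of_nonneg_left (Real.rpow_le_rpow_of_nonpos hδ hx (by linarith)) hα.le
  have h2 : LipschitzWith 1 (fun x : ℝ => max x δ) := LipschitzWith.id.max_const δ
  refine ⟨Real.toNNReal (α * δ ^ (-α - 1)), ?_⟩
  intro x y
  have := h1 (le_max_right x δ : max x δ ∈ Ici δ) (le_max_right y δ : max y δ ∈ Ici δ)
  simp only [Real.rpow_neg (hδ.le.trans (le_max_right _ δ))] at this
  refine this.trans ?_
  gcongr
  simpa using h2 x y

lemma aux_picard (α δ : ℝ) (hα : 0 < α) (hδ : 0 < δ) (k h : ℝ → ℝ)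
    (hk : ContinuousOn k (Icc 0 1)) (hh : ContinuousOn h (Icc 0 1)) :
    ∃ z : ℝ → ℝ, z 1 = 0 ∧ ContinuousOn z (Icc 0 1) ∧
      ∀ u ∈ Ioo (0:ℝ) 1, HasDerivAt z (k u - h u / max (z u) δ ^ α) u := by
  obtain ⟨K, hK⟩ := isCompact_Icc.exists_bound_of_continuousOn hk
  obtain ⟨H, hH⟩ := isCompact_Icc.exists_bound_of_continuousOn hh
  obtain ⟨C, hC⟩ := aux_lip_s16 α δ hα hδ
  have hH0 : 0 ≤ H := (norm_nonneg _).trans (hH 0 (by simp))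
  have hK0 : 0 ≤ K := (norm_nonneg _).trans (hK 0 (by simp))
  have hbd : ∀ x : ℝ, |(max x δ ^ α)⁻¹| ≤ (δ ^ α)⁻¹ := by
    intro x
    have : 0 < max x δ := hδ.trans_le (le_max_right _ _)
    rw [abs_of_pos (by positivity)]
    gcongr
    exact le_max_right _ _
  have hM0 : 0 ≤ K + H * (δ ^ α)⁻¹ := by positivity
  have hPL : IsPicardLindelof (fun t x => k t - h t / max x δ ^ α)
      (⟨1, by simp⟩ : Icc (0:ℝ) 1) (0:ℝ) (Real.toNNReal (K + H * (δ ^ α)⁻¹)) 0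
      (Real.toNNReal (K + H * (δ ^ α)⁻¹)) (Real.toNNReal H * C) := by
    refine ⟨?_, ?_, ?_, ?_⟩
    · intro t ht
      apply LipschitzOnWith.of_dist_le_mul
      intro x _ y _
      have h1 := hC.dist_le_mul x y
      rw [Real.dist_eq] at h1 ⊢
      have : k t - h t / max x δ ^ α - (k t - h t / max y δ ^ α)
        = - (h t * ((max x δ ^ α)⁻¹ - (max y δ ^ α)⁻¹)) := by ring
      rw [this, abs_neg, abs_mul, NNReal.coe_mul, Real.coe_toNNReal _ hH0, mul_assoc]
      exact mul_le_mul (hH t ht) h1 (abs_nonneg _) hH0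
    · intro x _
      exact hk.sub (hh.div_const _)
    · intro t ht x _
      rw [Real.coe_toNNReal _ hM0, div_eq_mul_inv]
      refine (norm_sub_le _ _).trans (add_le_add (hK t ht) ?_)
      rw [norm_mul]
      exact mul_le_mul (hH t ht) (hbd x) (norm_nonneg _) hH0
    · simp
  obtain ⟨z, hz1, hz⟩ := hPL.exists_eq_forall_mem_Icc_hasDerivWithinAt₀
  refine ⟨z, hz1, fun u hu => (hz u hu).continuousWithinAt, fun u hu => ?_⟩
  exact (hz u (Ioo_subset_Icc_self hu)).hasDerivAt (Icc_mem_nhds hu.1 hu.2)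

/-- Passing to the limit. -/
lemma aux_limit (a b M : ℝ) (Z F : ℕ → ℝ → ℝ) (ζ G : ℝ → ℝ)
    (hZ : ∀ n, ∀ u ∈ Icc a b, HasDerivAt (Z n) (F n u) u)
    (hF : ∀ n, ContinuousOn (F n) (Icc a b))
    (hM : ∀ n, ∀ u ∈ Icc a b, |F n u| ≤ M)
    (hlZ : ∀ u ∈ Icc a b, Tendsto (fun n => Z n u) atTop (𝓝 (ζ u)))
    (hlF : ∀ u ∈ Icc a b, Tendsto (fun n => F n u) atTop (𝓝 (G u)))
    (hG : ContinuousOn ζ (Icc a b) → ContinuousOn G (Icc a b)) :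
    ∀ u ∈ Ioo a b, HasDerivAt ζ (G u) u := by
  intro u hu
  have hab : a ≤ b := (hu.1.trans hu.2).le
  have hM0 : 0 ≤ M := (abs_nonneg _).trans (hM 0 u (Ioo_subset_Icc_self hu))
  have hlip : ContinuousOn ζ (Icc a b) := by
    have : LipschitzOnWith (Real.toNNReal M) ζ (Icc a b) := by
      apply LipschitzOnWith.of_dist_le_mul
      intro x hx y hy
      rw [Real.coe_toNNReal _ hM0]
      refine le_of_tendsto ((hlZ x hx).dist (hlZ y hy)) (Eventually.of_forall fun n => ?_)
      have := (convex_Icc a b).norm_image_sub_le_of_norm_hasDerivWithin_le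
        (fun v hv => (hZ n v hv).hasDerivWithinAt) (hM n) hy hx
      simpa [Real.dist_eq] using this
    exact this.continuousOn
  have hGc := hG hlip
  have key : ∀ x ∈ Icc a b, ζ x = ζ a + ∫ t in a..x, G t := by
    intro x hx
    have hsub : Icc a x ⊆ Icc a b := Icc_subset_Icc le_rfl hx.2
    have hsub' : uIoc a x ⊆ Icc a b := by
      rw [uIoc_of_le hx.1]; exact Ioc_subset_Icc_self.trans hsub
    have h1 : Tendsto (fun n => ∫ t in a..x, F n t) atTop (𝓝 (∫ t in a..x, G t)) := by
      apply tendsto_integral_filter_of_dominated_convergence (fun _ => M)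
      · exact Eventually.of_forall fun n => ((hF n).mono hsub').aestronglyMeasurable measurableSet_uIoc
      · exact Eventually.of_forall fun n => Eventually.of_forall fun t ht => hM n t (hsub' ht)
      · exact intervalIntegrable_const
      · exact Eventually.of_forall fun t ht => hlF t (hsub' ht)
    have h2 : ∀ n, ∫ t in a..x, F n t = Z n x - Z n a := by
      intro n
      apply integral_eq_sub_of_hasDerivAt
      · rw [uIcc_of_le hx.1]; exact fun t ht => hZ n t (hsub ht)
      · apply ContinuousOn.intervalIntegrable
        rw [uIcc_of_le hx.1]; exact (hF n).mono hsub
    simp only [h2] at h1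
    have := tendsto_nhds_unique h1 ((hlZ x hx).sub (hlZ a ⟨le_rfl, hab⟩))
    linarith
  have hn : Icc a b ∈ 𝓝 u := Icc_mem_nhds hu.1 hu.2
  have h3 : HasDerivAt (fun x => ∫ t in a..x, G t) (G u) u := by
    apply integral_hasDerivAt_right
    · apply ContinuousOn.intervalIntegrable
      rw [uIcc_of_le hu.1.le]; exact hGc.mono (Icc_subset_Icc le_rfl hu.2.le)
    · exact ⟨Icc a b, hn, hGc.aestronglyMeasurable measurableSet_Icc⟩
    · exact hGc.continuousAt hn
  refine (h3.const_add (ζ a)).congr_of_eventuallyEq ?_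
  filter_upwards [hn] with x hx using key x hx

/-- If problem (P) has a solution `z*` for the speed `c*`, then it has a
solution for every speed `c > c*`; hence the set of admissible speeds is a
half-line. -/
theorem stmt_16 (α : ℝ) (hα : 0 < α) (f g h : ℝ → ℝ)
    (hf : ContinuousOn f (Icc 0 1)) (hg : ContinuousOn g (Icc 0 1))
    (hh : ContinuousOn h (Icc 0 1))
    (hh0 : h 0 = 0) (hh1 : h 1 = 0) (hhpos : ∀ u ∈ Ioo (0:ℝ) 1, 0 < h u)
    (hg0 : 0 < g 0) (hgint : ∀ u ∈ Ioc (0:ℝ) 1, 0 < ∫ s in (0:ℝ)..u, g s)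
    (cstar : ℝ) (zstar : ℝ → ℝ)
    (hzstar : ∀ u ∈ Ioo (0:ℝ) 1,
      HasDerivAt zstar (cstar * g u - f u - h u / zstar u ^ α) u)
    (hzstarpos : ∀ u ∈ Ioo (0:ℝ) 1, 0 < zstar u)
    (hzstar0 : Tendsto zstar (𝓝[>] (0:ℝ)) (𝓝 0))
    (hzstar1 : Tendsto zstar (𝓝[<] (1:ℝ)) (𝓝 0)) :
    ∀ c : ℝ, cstar < c → ∃ z : ℝ → ℝ,
      (∀ u ∈ Ioo (0:ℝ) 1, HasDerivAt z (c * g u - f u - h u / z u ^ α) u) ∧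
      (∀ u ∈ Ioo (0:ℝ) 1, 0 < z u) ∧
      Tendsto z (𝓝[>] (0:ℝ)) (𝓝 0) ∧
      Tendsto z (𝓝[<] (1:ℝ)) (𝓝 0) := by
  intro c hc
  have hk : ContinuousOn (fun u => c * g u - f u) (Icc 0 1) := (hg.const_smul c).sub hf
  obtain ⟨K, hK⟩ := isCompact_Icc.exists_bound_of_continuousOn hk
  obtain ⟨H, hH⟩ := isCompact_Icc.exists_bound_of_continuousOn hh
  have hH0 : 0 ≤ H := (norm_nonneg _).trans (hH 0 (by simp))
  have hK0 : 0 ≤ K := (norm_nonneg _).trans (hK 0 (by simp))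
  simp only [Real.norm_eq_abs] at hK hH
  have hdiv : ∀ u ∈ Ioo (0:ℝ) 1, ∀ x y : ℝ, 0 < x → x ≤ y → h u / y ^ α ≤ h u / x ^ α := by
    intro u hu x y hx hxy
    have := hhpos u hu
    gcongr
  -- truncated problems
  let δ : ℕ → ℝ := fun n => 1 / ((n : ℝ) + 1)
  have hδ : ∀ n, 0 < δ n := fun n => by positivity
  have hδ1 : ∀ n, δ n ≤ 1 := fun n => by
    simp only [δ]
    rw [div_le_one (by positivity)]
    linarith [(Nat.cast_nonneg n : (0:ℝ) ≤ n)]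
  have hδanti : Antitone δ := fun m n hmn => one_div_le_one_div_of_le (by positivity)
    (by have : (m:ℝ) ≤ n := by exact_mod_cast hmn
        linarith)
  have hδlim : Tendsto δ atTop (𝓝 0) := tendsto_one_div_add_atTop_nhds_zero_nat
  choose Z hZ1 hZc hZd using fun n => aux_picard α (δ n) hα (hδ n) _ h hk hh
  have hmaxpos : ∀ n u, 0 < max (Z n u) (δ n) := fun n u => (hδ n).trans_le (le_max_right _ _)
  have hsubc : ∀ u ∈ Ioo (0:ℝ) 1, ∀ b ≤ 1, Icc u b ⊆ Icc 0 1 :=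
    fun u hu b hb => Icc_subset_Icc hu.1.le hb
  have hsubo : ∀ u ∈ Ioo (0:ℝ) 1, ∀ b ≤ 1, Ioo u b ⊆ Ioo 0 1 :=
    fun u hu b hb => Ioo_subset_Ioo hu.1.le hb
  -- monotonicity in n
  have hmono : ∀ u ∈ Ioo (0:ℝ) 1, Monotone (fun n => Z n u) := by
    intro u hu m n hmn
    have := aux_comp (fun v => Z m v - Z n v) _ u 1 hu.2.le
      (((hZc m).sub (hZc n)).mono (hsubc u hu 1 le_rfl))
      (fun v hv => (hZd m v (hsubo u hu 1 le_rfl hv)).sub (hZd n v (hsubo u hu 1 le_rfl hv)))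
      (by
        intro v hv hpos
        have := hdiv v (hsubo u hu 1 le_rfl hv) _ _ (hmaxpos n v)
          (max_le_max (by linarith : Z n v ≤ Z m v) (hδanti hmn))
        linarith)
      (by simp [hZ1])
    simp only at this ⊢
    linarith
  -- upper bound
  let G : ℝ → ℝ := fun u => ∫ s in (0:ℝ)..u, g s
  have hGc : ContinuousOn G (Icc 0 1) := by
    have := continuousOn_primitive_interval (μ := MeasureTheory.volume) (f := g) (a := 0) (b := 1)
      (by rw [uIcc_of_le zero_le_one]; exact hg.integrableOn_Icc)
    rwa [uIcc_of_le zero_le_one] at this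
  have hGd : ∀ u ∈ Ioo (0:ℝ) 1, HasDerivAt G (g u) u := by
    intro u hu
    have hn : Icc (0:ℝ) 1 ∈ 𝓝 u := Icc_mem_nhds hu.1 hu.2
    apply integral_hasDerivAt_right
    · apply ContinuousOn.intervalIntegrable
      rw [uIcc_of_le hu.1.le]; exact hg.mono (Icc_subset_Icc le_rfl hu.2.le)
    · exact ⟨Icc 0 1, hn, hg.aestronglyMeasurable measurableSet_Icc⟩
    · exact hg.continuousAt hn
  have hleft : 𝓝[<] (1:ℝ) ≤ 𝓝[Icc 0 1] 1 := by
    rw [← nhdsWithin_Ioo_eq_nhdsLT (zero_lt_one (α := ℝ))]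
    exact nhdsWithin_mono _ Ioo_subset_Icc_self
  have hright : 𝓝[>] (0:ℝ) ≤ 𝓝[Icc 0 1] 0 := by
    rw [← nhdsWithin_Ioo_eq_nhdsGT (zero_lt_one (α := ℝ))]
    exact nhdsWithin_mono _ Ioo_subset_Icc_self
  let Y : ℝ → ℝ := fun u => zstar u + (c - cstar) * G u
  have hY0 : Tendsto Y (𝓝[>] (0:ℝ)) (𝓝 0) := by
    have h1 : Tendsto G (𝓝[>] (0:ℝ)) (𝓝 (G 0)) := (hGc 0 (by simp)).mono_left hright
    have h2 := hzstar0.add (h1.const_mul (c - cstar))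
    simpa [G] using h2
  have hYd : ∀ u ∈ Ioo (0:ℝ) 1, HasDerivAt Y (c * g u - f u - h u / zstar u ^ α) u := by
    intro u hu
    have h1 := (hzstar u hu).add ((hGd u hu).const_mul (c - cstar))
    have h2 : cstar * g u - f u - h u / zstar u ^ α + (c - cstar) * g u
        = c * g u - f u - h u / zstar u ^ α := by ring
    rw [h2] at h1
    exact h1
  have hYz : ∀ u ∈ Ioo (0:ℝ) 1, zstar u ≤ Y u := by
    intro u hu
    have := mul_pos (sub_pos.2 hc) (hgint u ⟨hu.1, hu.2.le⟩)
    simp only [Y, G]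
    linarith
  have hZY : ∀ n, ∀ u ∈ Ioo (0:ℝ) 1, Z n u ≤ Y u := by
    intro n u hu
    have h1 : Tendsto (fun v => Z n v - Y v) (𝓝[<] (1:ℝ))
        (𝓝 (Z n 1 - (0 + (c - cstar) * G 1))) :=
      ((hZc n 1 (by simp)).mono_left hleft).sub
        (hzstar1.add (((hGc 1 (by simp)).mono_left hleft).const_mul _))
    have hneg : Z n 1 - (0 + (c - cstar) * G 1) < 0 := by
      have := mul_pos (sub_pos.2 hc) (hgint 1 (by simp))
      simp only [hZ1, G]
      linarith
    obtain ⟨b, hb, hbu⟩ := ((h1.eventually_lt_const hneg).and (Ioo_mem_nhdsLT hu.2)).exists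
    have hcd : ∀ v ∈ Icc u b, v ∈ Ioo (0:ℝ) 1 := fun v hv =>
      ⟨hu.1.trans_le hv.1, hv.2.trans_lt hbu.2⟩
    have := aux_comp (fun v => Z n v - Y v) _ u b hbu.1.le
      (fun v hv => ((hZd n v (hcd v hv)).sub
        (hYd v (hcd v hv))).continuousAt.continuousWithinAt)
      (fun v hv => (hZd n v (hcd v (Ioo_subset_Icc_self hv))).sub
        (hYd v (hcd v (Ioo_subset_Icc_self hv))))
      (by
        intro v hv hpos
        have hv' := hcd v (Ioo_subset_Icc_self hv)
        have := hdiv v hv' _ _ (hzstarpos v hv')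
          (((hYz v hv').trans (by linarith)).trans (le_max_left (Z n v) (δ n)))
        linarith)
      hb.le
    linarith
  -- upper bound near 1
  have hZ1up : ∀ ε > 0, ∀ n, ∀ u ∈ Ioo (0:ℝ) 1, Z n u ≤ ε + (K + H / ε ^ α) * (1 - u) := by
    intro ε hε n u hu
    have := aux_comp (fun v => Z n v - (ε + (K + H / ε ^ α) * (1 - v)))
      (fun v => (c * g v - f v - h v / max (Z n v) (δ n) ^ α) - (K + H / ε ^ α) * (-1)) u 1 hu.2.le
      (((hZc n).mono (hsubc u hu 1 le_rfl)).sub (by fun_prop))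
      (fun v hv => (hZd n v (hsubo u hu 1 le_rfl hv)).sub
        ((((hasDerivAt_id v).const_sub 1).const_mul _).const_add _))
      (by
        intro v hv hpos
        have hv' := hsubo u hu 1 le_rfl hv
        have h0 : 0 ≤ (K + H / ε ^ α) * (1 - v) :=
          mul_nonneg (by positivity) (by linarith [hv'.2])
        have h1 := hdiv v hv' ε _ hε
          ((by linarith : ε ≤ Z n v).trans (le_max_left (Z n v) (δ n)))
        have h2 : h v / ε ^ α ≤ H / ε ^ α := by
          have := (le_abs_self _).trans (hH v (Ioo_subset_Icc_self hv'))
          gcongr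
        have h3 := (abs_le.1 (hK v (Ioo_subset_Icc_self hv'))).1
        linarith)
      (by simp [hZ1, hε.le])
    linarith
  -- lower bounds
  have hZlow : ∀ n, ∀ u ∈ Ioo (0:ℝ) 1, -K ≤ Z n u := by
    intro n u hu
    have := aux_comp (fun v => K * (v - 1) - Z n v)
      (fun v => K * 1 - (c * g v - f v - h v / max (Z n v) (δ n) ^ α)) u 1 hu.2.le
      ((by fun_prop : ContinuousOn (fun v : ℝ => K * (v - 1)) _).sub
        ((hZc n).mono (hsubc u hu 1 le_rfl)))
      (fun v hv => (((hasDerivAt_id v).sub_const 1).const_mul K).sub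
        (hZd n v (hsubo u hu 1 le_rfl hv)))
      (by
        intro v hv _
        have hv' := hsubo u hu 1 le_rfl hv
        have h3 := (abs_le.1 (hK v (Ioo_subset_Icc_self hv'))).2
        have h4 := hhpos v hv'
        have h5 := hmaxpos n v
        have : 0 ≤ h v / max (Z n v) (δ n) ^ α := by positivity
        linarith)
      (by simp [hZ1])
    nlinarith [hu.1]
  have hZpos : ∀ u ∈ Ioo (0:ℝ) 1, ∃ n, 0 < Z n u := by
    intro u hu
    obtain ⟨b, hub, hb1⟩ := exists_between hu.2
    have hsb : Icc u b ⊆ Ioo 0 1 := fun v hv => ⟨hu.1.trans_le hv.1, hv.2.trans_lt hb1⟩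
    obtain ⟨w, hw, hwmin⟩ := isCompact_Icc.exists_isMinOn (nonempty_Icc.2 hub.le)
      (hh.mono (hsubc u hu b hb1.le))
    have hm : 0 < h w := hhpos w (hsb hw)
    have hl : Tendsto (fun n => (K + (K + 1) / (b - u)) * δ n ^ α) atTop (𝓝 0) := by
      have h1 : Tendsto (fun n => δ n ^ α) atTop (𝓝 (0 ^ α)) :=
        hδlim.rpow_const (Or.inr hα.le)
      rw [Real.zero_rpow hα.ne'] at h1
      simpa using h1.const_mul (K + (K + 1) / (b - u))
    obtain ⟨n, hn⟩ := (hl.eventually_lt_const hm).exists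
    refine ⟨n, ?_⟩
    have hbu : 0 < b - u := sub_pos.2 hub
    have hδn := hδ n
    set q := (K + δ n) / (b - u) with hq
    have hq0 : 0 ≤ q := by positivity
    have hqb : q * (b - u) = K + δ n := by rw [hq]; field_simp
    have hqle : q ≤ (K + 1) / (b - u) := by
      have := hδ1 n
      rw [hq]; gcongr
    have := aux_comp (fun v => (-K + q * (b - v)) - Z n v)
      (fun v => q * (-1) - (c * g v - f v - h v / max (Z n v) (δ n) ^ α)) u b hub.le
      ((by fun_prop : ContinuousOn (fun v : ℝ => -K + q * (b - v)) _).sub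
        ((hZc n).mono (hsubc u hu b hb1.le)))
      (fun v hv => ((((hasDerivAt_id v).const_sub b).const_mul q).const_add (-K)).sub
        (hZd n v (hsubo u hu b hb1.le hv)))
      (by
        intro v hv hpos
        have hv' := hsubo u hu b hb1.le hv
        have h3 := (abs_le.1 (hK v (Ioo_subset_Icc_self hv'))).2
        have h4 : q * (b - v) ≤ q * (b - u) :=
          mul_le_mul_of_nonneg_left (by linarith [hv.1]) hq0
        have h5 : max (Z n v) (δ n) = δ n := max_eq_right (by linarith)
        have h6 : h w ≤ h v := hwmin (Ioo_subset_Icc_self hv)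
        have h7 : K + (K + 1) / (b - u) ≤ h v / δ n ^ α := by
          rw [le_div_iff₀ (by positivity)]
          linarith
        rw [h5]
        linarith)
      (by
        have := hZlow n b (hsb ⟨hub.le, le_rfl⟩)
        simp only [sub_self, mul_zero]
        linarith)
    linarith
  -- the limit
  let ζ : ℝ → ℝ := fun u => ⨆ n, Z n u
  have hbdd : ∀ u ∈ Ioo (0:ℝ) 1, BddAbove (range fun n => Z n u) := by
    rintro u hu
    exact ⟨Y u, by rintro _ ⟨n, rfl⟩; exact hZY n u hu⟩
  have hζlim : ∀ u ∈ Ioo (0:ℝ) 1, Tendsto (fun n => Z n u) atTop (𝓝 (ζ u)) :=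
    fun u hu => tendsto_atTop_ciSup (hmono u hu) (hbdd u hu)
  have hζge : ∀ n, ∀ u ∈ Ioo (0:ℝ) 1, Z n u ≤ ζ u := fun n u hu => le_ciSup (hbdd u hu) n
  have hζpos : ∀ u ∈ Ioo (0:ℝ) 1, 0 < ζ u := by
    intro u hu
    obtain ⟨n, hn⟩ := hZpos u hu
    exact hn.trans_le (hζge n u hu)
  refine ⟨ζ, ?_, hζpos, ?_, ?_⟩
  · intro u hu
    obtain ⟨N, hN⟩ := hZpos u hu
    set η := Z N u / 2 with hη
    have hη0 : 0 < η := by positivity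
    have hev : ∀ᶠ v in 𝓝 u, η < Z N v ∧ v ∈ Ioo (0:ℝ) 1 :=
      ((hZd N u hu).continuousAt.eventually_const_lt (by linarith)).and (Ioo_mem_nhds hu.1 hu.2)
    obtain ⟨l, r, hlr, hsub⟩ := mem_nhds_iff_exists_Ioo_subset.1 hev
    obtain ⟨a, hla, hau⟩ := exists_between hlr.1
    obtain ⟨b, hub, hbr⟩ := exists_between hlr.2
    have hI : ∀ v ∈ Icc a b, η < Z N v ∧ v ∈ Ioo (0:ℝ) 1 := fun v hv =>
      hsub ⟨hla.trans_le hv.1, hv.2.trans_lt hbr⟩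
    have hI01 : Icc a b ⊆ Icc 0 1 := fun v hv => Ioo_subset_Icc_self (hI v hv).2
    have hηZ : ∀ n, ∀ v ∈ Icc a b, η ≤ Z (n + N) v := fun n v hv =>
      (hI v hv).1.le.trans (hmono v (hI v hv).2 (Nat.le_add_left N n))
    refine aux_limit a b (K + H / η ^ α) (fun n => Z (n + N))
      (fun n v => c * g v - f v - h v / max (Z (n + N) v) (δ (n + N)) ^ α) ζ
      (fun v => c * g v - f v - h v / ζ v ^ α) ?_ ?_ ?_ ?_ ?_ ?_ u ⟨hau, hub⟩
    · exact fun n v hv => hZd _ v (hI v hv).2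
    · intro n
      refine (hk.mono hI01).sub ((hh.mono hI01).div
        (((((hZc (n + N)).mono hI01)).sup continuousOn_const).rpow_const
          fun v hv => Or.inr hα.le) ?_)
      intro v hv
      exact (Real.rpow_pos_of_pos (hmaxpos _ _) _).ne'
    · intro n v hv
      have hv' := (hI v hv).2
      have h1 := hdiv v hv' η _ hη0 ((hηZ n v hv).trans (le_max_left _ (δ (n + N))))
      have h2 : h v / η ^ α ≤ H / η ^ α := by
        have := (le_abs_self _).trans (hH v (Ioo_subset_Icc_self hv'))
        gcongr
      have h3 := abs_le.1 (hK v (Ioo_subset_Icc_self hv'))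
      have h4 := hhpos v hv'
      have h5 := hmaxpos (n + N) v
      have h6 : 0 ≤ h v / max (Z (n + N) v) (δ (n + N)) ^ α := by positivity
      have h7 : 0 ≤ H / η ^ α := by positivity
      rw [abs_le]
      constructor <;> linarith [h3.1, h3.2]
    · intro v hv
      exact (hζlim v (hI v hv).2).comp (tendsto_add_atTop_nat N)
    · intro v hv
      have hp := hζpos v (hI v hv).2
      have h1 : Tendsto (fun n => max (Z n v) (δ n)) atTop (𝓝 (max (ζ v) 0)) :=
        (hζlim v (hI v hv).2).max hδlim
      rw [max_eq_left hp.le] at h1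
      have h2 := (tendsto_const_nhds (x := h v)).div (h1.rpow_const (p := α) (Or.inr hα.le))
        (Real.rpow_pos_of_pos hp α).ne'
      exact (h2.const_sub (c * g v - f v)).comp (tendsto_add_atTop_nat N)
    · intro hζc
      refine (hk.mono hI01).sub ((hh.mono hI01).div
        (hζc.rpow_const fun v hv => Or.inr hα.le) ?_)
      intro v hv
      exact (Real.rpow_pos_of_pos (hζpos v (hI v hv).2) _).ne'
  · refine tendsto_of_tendsto_of_tendsto_of_le_of_le' tendsto_const_nhds hY0 ?_ ?_
    · filter_upwards [Ioo_mem_nhdsGT (zero_lt_one (α := ℝ))] with u hu using (hζpos u hu).le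
    · filter_upwards [Ioo_mem_nhdsGT (zero_lt_one (α := ℝ))] with u hu
      exact ciSup_le fun n => hZY n u hu
  · rw [tendsto_order]
    constructor
    · intro a ha
      filter_upwards [Ioo_mem_nhdsLT (zero_lt_one (α := ℝ))] with u hu
      exact ha.trans (hζpos u hu)
    · intro a ha
      have hl : Tendsto (fun u : ℝ => a / 2 + (K + H / (a / 2) ^ α) * (1 - u)) (𝓝[<] 1)
          (𝓝 (a / 2 + (K + H / (a / 2) ^ α) * (1 - 1))) :=
        (Continuous.tendsto (by fun_prop) 1).mono_left nhdsWithin_le_nhds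
      have hlt : a / 2 + (K + H / (a / 2) ^ α) * (1 - 1) < a := by
        simp only [sub_self, mul_zero]; linarith
      filter_upwards [Ioo_mem_nhdsLT (zero_lt_one (α := ℝ)), hl.eventually_lt_const hlt]
        with u hu hu2
      exact (ciSup_le fun n => hZ1up (a / 2) (by linarith) n u hu).trans_lt hu2
end
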